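/- Let (Ω, Σ, μ) be a measure space, let 1 ≤ r < p < ∞, and let f₁, …, fₙ : Ω → ℝ be measurable functions with pairwise disjoint supports (f_i · f_j = 0 μ-almost everywhere whenever i ≠ j) and ‖fᵢ‖_{L^{[r]}_{p,∞}(μ)} < ∞ for every i. Then ‖Σ_{i=1}^n |f_i|‖_{L^{[r]}_{p,∞}(μ)} ≤ (Σ_{i=1}^n ‖f_i‖_{L^{[r]}_{p,∞}(μ)}^p)^{1/p}. In other words, the norm ‖·‖_{L^{[r]}_{p,∞}} satisfies an upper p-estimate with constant 1. -/

import Mathlib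

noncomputable section

open scoped BigOperators ENNReal
open MeasureTheory

/-- The `L^{[r]}_{p,∞}(μ)` norm of a measurable function `f : Ω → ℝ`:
`sup { μ(A)^{1/p − 1/r} (∫_A |f|^r dμ)^{1/r} : 0 < μ(A) < ∞ }`, valued in `ℝ≥0∞`. -/
def weakNorm {Ω : Type*} [MeasurableSpace Ω] (μ : Measure Ω) (p r : ℝ)
    (f : Ω → ℝ) : ℝ≥0∞ :=
  ⨆ (A : Set Ω) (_ : MeasurableSet A) (_ : 0 < μ A) (_ : μ A ≠ ∞),
    μ A ^ (1 / p - 1 / r) * (∫⁻ a in A, ENNReal.ofReal (|f a| ^ r) ∂μ) ^ (1 / r)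

/-- Bound of the integral over `A` by the weak norm. -/
theorem weakNorm_lintegral_le {Ω : Type*} [MeasurableSpace Ω] (μ : Measure Ω)
    (p r : ℝ) (hr : 1 ≤ r) (hrp : r < p) (f : Ω → ℝ) (hf : Measurable f)
    (A : Set Ω) (hA : MeasurableSet A) (hfinA : μ A ≠ ∞) :
    ∫⁻ a in A, ENNReal.ofReal (|f a| ^ r) ∂μ ≤
      weakNorm μ p r f ^ r * μ (A ∩ {a | f a ≠ 0}) ^ (1 - r / p) := by
  have hr0 : 0 < r := by linarith
  have hp0 : 0 < p := by linarith
  have hS : MeasurableSet {a | f a ≠ 0} := (hf (measurableSet_singleton 0)).compl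
  set B := A ∩ {a | f a ≠ 0} with hB
  have hBm : MeasurableSet B := hA.inter hS
  have h1 : ∫⁻ a in A, ENNReal.ofReal (|f a| ^ r) ∂μ
      = ∫⁻ a in B, ENNReal.ofReal (|f a| ^ r) ∂μ := by
    rw [← lintegral_indicator hA, ← lintegral_indicator hBm]
    congr 1
    funext a
    by_cases ha : a ∈ A <;> by_cases h0 : f a = 0 <;>
      simp [hB, Set.indicator, ha, h0, Real.zero_rpow hr0.ne']
  rw [h1]
  have hBfin : μ B ≠ ∞ := ne_top_of_le_ne_top hfinA (measure_mono Set.inter_subset_left)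
  rcases eq_or_ne (μ B) 0 with h0 | h0
  · rw [setLIntegral_measure_zero _ _ h0]; exact zero_le
  have h2 : μ B ^ (1 / p - 1 / r) * (∫⁻ a in B, ENNReal.ofReal (|f a| ^ r) ∂μ) ^ (1 / r)
      ≤ weakNorm μ p r f := by
    unfold weakNorm
    exact le_iSup₂_of_le B hBm (le_iSup₂_of_le (pos_iff_ne_zero.2 h0) hBfin le_rfl)
  have h3 := ENNReal.rpow_le_rpow h2 hr0.le
  rw [ENNReal.mul_rpow_of_nonneg _ _ hr0.le, ← ENNReal.rpow_mul, ← ENNReal.rpow_mul,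
    one_div_mul_cancel hr0.ne', ENNReal.rpow_one] at h3
  calc ∫⁻ a in B, ENNReal.ofReal (|f a| ^ r) ∂μ
      = (μ B ^ ((1 / p - 1 / r) * r) * ∫⁻ a in B, ENNReal.ofReal (|f a| ^ r) ∂μ)
          * μ B ^ (1 - r / p) := by
        rw [mul_right_comm, ← ENNReal.rpow_add _ _ h0 hBfin]
        have : (1 / p - 1 / r) * r + (1 - r / p) = 0 := by field_simp; ring
        rw [this, ENNReal.rpow_zero, one_mul]
    _ ≤ _ := by gcongr

/-- The norm `‖·‖_{L^{[r]}_{p,∞}}` satisfies an upper `p`-estimate with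
constant 1 on functions with pairwise disjoint supports. -/
theorem weakNorm_upper_p_estimate
    {Ω : Type*} [MeasurableSpace Ω] (μ : Measure Ω)
    (p r : ℝ) (hr : 1 ≤ r) (hrp : r < p)
    (n : ℕ) (f : Fin n → Ω → ℝ) (hmeas : ∀ i, Measurable (f i))
    (hdisj : ∀ i j, i ≠ j → ∀ᵐ a ∂μ, f i a * f j a = 0)
    (hfin : ∀ i, weakNorm μ p r (f i) ≠ ∞) :
    weakNorm μ p r (fun a => ∑ i, |f i a|) ≤
      (∑ i, weakNorm μ p r (f i) ^ p) ^ (1 / p) := by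
  have hr0 : 0 < r := by linarith
  have hp0 : 0 < p := by linarith
  conv_lhs => unfold weakNorm
  refine iSup₂_le fun A hA => iSup₂_le fun hA0 hAfin => ?_
  have hdisj' : ∀ᵐ a ∂μ, ∀ i j, i ≠ j → f i a * f j a = 0 := by
    rw [ae_all_iff]; intro i
    rw [ae_all_iff]; intro j
    by_cases h : i = j
    · simp [h]
    · filter_upwards [hdisj i j h] with a ha _ using ha
  have h1 : ∫⁻ a in A, ENNReal.ofReal (|(∑ i, |f i a|)| ^ r) ∂μ
      = ∑ i, ∫⁻ a in A, ENNReal.ofReal (|f i a| ^ r) ∂μ := by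
    rw [← lintegral_finsetSum _ (fun i _ => by have := hmeas i; fun_prop)]
    refine lintegral_congr_ae (ae_restrict_of_ae ?_)
    filter_upwards [hdisj'] with a ha
    by_cases hz : ∀ i, f i a = 0
    · simp [hz, Real.zero_rpow hr0.ne']
    · push Not at hz
      obtain ⟨k, hk⟩ := hz
      have hz : ∀ j, j ≠ k → f j a = 0 := fun j hj =>
        (mul_eq_zero.1 (ha j k hj)).resolve_right hk
      rw [Finset.sum_eq_single k (fun j _ hj => by simp [hz j hj]) (by simp),
        Finset.sum_eq_single k
          (fun j _ hj => by simp [hz j hj, Real.zero_rpow hr0.ne']) (by simp), abs_abs]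
  have hS : ∀ i, MeasurableSet (A ∩ {a | f i a ≠ 0}) := fun i =>
    hA.inter ((hmeas i) (measurableSet_singleton 0)).compl
  have h2 : ∑ i, μ (A ∩ {a | f i a ≠ 0}) ≤ μ A := by
    rw [← measure_biUnion_finset₀ (s := Finset.univ) (f := fun i => A ∩ {a | f i a ≠ 0})
      _ (fun i _ => (hS i).nullMeasurableSet)]
    · exact measure_mono (Set.iUnion₂_subset fun i _ => Set.inter_subset_left)
    · intro i _ j _ hij
      refine measure_mono_null ?_ (ae_iff.1 (hdisj i j hij))
      rintro a ⟨⟨_, h1⟩, ⟨_, h2⟩⟩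
      exact mul_ne_zero h1 h2
  have hrp1 : 0 < 1 - r / p := by rw [sub_pos, div_lt_one hp0]; exact hrp
  have hconj : (p / r).HolderConjugate (1 - r / p)⁻¹ := by
    rw [Real.holderConjugate_iff]
    refine ⟨(one_lt_div hr0).2 hrp, ?_⟩
    rw [inv_inv, inv_div]; ring
  have h3 : ∫⁻ a in A, ENNReal.ofReal (|(∑ i, |f i a|)| ^ r) ∂μ
      ≤ (∑ i, weakNorm μ p r (f i) ^ p) ^ (r / p) * μ A ^ (1 - r / p) := by
    rw [h1]
    refine (Finset.sum_le_sum fun i _ =>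
      weakNorm_lintegral_le μ p r hr hrp (f i) (hmeas i) A hA hAfin).trans ?_
    refine (ENNReal.inner_le_Lp_mul_Lq Finset.univ _ _ hconj).trans ?_
    simp only [← ENNReal.rpow_mul, mul_inv_cancel₀ hrp1.ne', ENNReal.rpow_one, one_div, inv_inv,
      inv_div, mul_div_cancel₀ p hr0.ne']
    gcongr
  calc _ ≤ μ A ^ (1 / p - 1 / r) *
        ((∑ i, weakNorm μ p r (f i) ^ p) ^ (r / p) * μ A ^ (1 - r / p)) ^ (1 / r) := by gcongr
    _ = (∑ i, weakNorm μ p r (f i) ^ p) ^ (1 / p) *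
        μ A ^ ((1 / p - 1 / r) + (1 - r / p) * (1 / r)) := by
      rw [ENNReal.mul_rpow_of_nonneg _ _ (by positivity), ← ENNReal.rpow_mul, ← ENNReal.rpow_mul,
        ENNReal.rpow_add _ _ hA0.ne' hAfin]
      have : r / p * (1 / r) = 1 / p := by field_simp
      rw [this]; ring
    _ = _ := by
      have : (1 / p - 1 / r) + (1 - r / p) * (1 / r) = 0 := by field_simp; ring
      rw [this, ENNReal.rpow_zero, mul_one]

end
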